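/- An affine semigroup algebra C[N(A)] for a finite set A ⊂ Z^d is normal (integrally closed in its fraction field) if and only if N(A) = Z(A) ∩ Q≥0(A), where Z(A) is the lattice generated by A, N(A) the semigroup generated by A, and Q≥0(A) the rational cone generated by A. -/

import Mathlib

open Finset Pointwise

/-- Coercion of an integer vector to a real vector. -/
def coeZ {n : ℕ} (v : Fin n → ℤ) : Fin n → ℝ := fun i => (v i : ℝ)

/-- The root `e_i - e_j` of `SL(n, ℂ)`, as an integer vector. -/
def rootZ (n : ℕ) (i j : Fin n) : Fin n → ℤ :=
  fun t => (if t = i then 1 else 0) - (if t = j then 1 else 0)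

/-- The root `e_i - e_j` as a real vector. -/
def rootR (n : ℕ) (i j : Fin n) : Fin n → ℝ :=
  fun t => (if t = i then 1 else 0) - (if t = j then 1 else 0)

/-- A vector is a root of `SL(n, ℂ)`. -/
def IsRootVec {n : ℕ} (v : Fin n → ℤ) : Prop :=
  ∃ i j : Fin n, i ≠ j ∧ v = rootZ n i j

/-- `E` is an edge (a one-dimensional face) of the set `P`. -/
def IsEdge {n : ℕ} (P E : Set (Fin n → ℝ)) : Prop :=
  IsExtreme ℝ P E ∧ Module.finrank ℝ (affineSpan ℝ E).direction = 1

/-- The edge `E` is parallel to the root `e_i - e_j` for some `i ≠ j`. -/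
def EdgeParallelRoot {n : ℕ} (E : Set (Fin n → ℝ)) : Prop :=
  ∃ i j : Fin n, i ≠ j ∧ ∀ x ∈ E, ∀ y ∈ E, ∃ c : ℝ, x - y = c • rootR n i j

/-- A finite subset of the root lattice of `SL(n, ℂ)` is root-saturated if every
edge of its convex hull is parallel to a root, and it equals the intersection of
its convex hull with the root lattice. -/
def RootSaturated {n : ℕ} (A : Finset (Fin n → ℤ)) : Prop :=
  (∀ v ∈ A, ∑ i, v i = 0) ∧
  (∀ E : Set (Fin n → ℝ),
      IsEdge (convexHull ℝ (coeZ '' (A : Set (Fin n → ℤ)))) E → EdgeParallelRoot E) ∧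
  (∀ v : Fin n → ℤ, ∑ i, v i = 0 →
      coeZ v ∈ convexHull ℝ (coeZ '' (A : Set (Fin n → ℤ))) → v ∈ A)

/-- The indicator vector (in `ℤ^n`) of a subset `S ⊆ {1, …, n}`. -/
def indZ {n : ℕ} (S : Finset (Fin n)) : Fin n → ℤ := fun i => if i ∈ S then 1 else 0

/-- The indicator vector (in `ℝ^n`) of a subset `S ⊆ {1, …, n}`. -/
def indR {n : ℕ} (S : Finset (Fin n)) : Fin n → ℝ := fun i => if i ∈ S then 1 else 0

/-- `B` is the collection of bases of a matroid on `{1, …, n}`: it is nonempty and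
satisfies the basis exchange axiom. -/
def IsMatroidBases {n : ℕ} (B : Finset (Finset (Fin n))) : Prop :=
  B.Nonempty ∧
  ∀ B₁ ∈ B, ∀ B₂ ∈ B, ∀ x ∈ B₁ \ B₂, ∃ y ∈ B₂ \ B₁, insert y (B₁.erase x) ∈ B

namespace AddMonoidAlgebra

section Laurent

variable (k σ : Type*) [Field k]

/-- The inclusion of the exponents of monomials into those of Laurent monomials. -/
def exponentHom : (σ →₀ ℕ) →+ (σ → ℤ) where
  toFun q i := q i
  map_zero' := by ext; simp
  map_add' p q := by ext; simp

lemma exponentHom_injective : Function.Injective (exponentHom σ) := by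
  intro p q h
  ext i
  exact Int.ofNat_inj.1 (congrFun h i)

lemma exists_mul_single_eq_mapDomain [Finite σ] (f : AddMonoidAlgebra k (σ → ℤ)) :
    ∃ (q : σ →₀ ℕ) (g : AddMonoidAlgebra k (σ →₀ ℕ)),
      f * single (exponentHom σ q) 1 = mapDomainRingHom k (exponentHom σ) g := by
  induction f using AddMonoidAlgebra.induction_linear with
  | zero => exact ⟨0, 0, by simp⟩
  | add f₁ f₂ h₁ h₂ =>
    obtain ⟨q₁, g₁, e₁⟩ := h₁
    obtain ⟨q₂, g₂, e₂⟩ := h₂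
    refine ⟨q₁ + q₂, g₁ * single q₂ 1 + g₂ * single q₁ 1, ?_⟩
    have hs : (single (exponentHom σ (q₁ + q₂)) 1 : AddMonoidAlgebra k (σ → ℤ)) =
        single (exponentHom σ q₁) 1 * single (exponentHom σ q₂) 1 := by
      simp [single_mul_single]
    have hm (q : σ →₀ ℕ) : mapDomainRingHom k (exponentHom σ) (single q 1) =
        single (exponentHom σ q) 1 := by simp
    rw [hs, (mapDomainRingHom k (exponentHom σ)).map_add,
      (mapDomainRingHom k (exponentHom σ)).map_mul,
      (mapDomainRingHom k (exponentHom σ)).map_mul, ← e₁, ← e₂, hm, hm]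
    ring
  | single v c =>
    refine ⟨Finsupp.equivFunOnFinite.symm fun i => (v i).natAbs,
      single (Finsupp.equivFunOnFinite.symm fun i => (v i + (v i).natAbs).toNat) c, ?_⟩
    simp only [single_mul_single, mul_one, mapDomainRingHom_apply, mapDomain_single]
    congr 1
    ext i
    simp only [exponentHom, AddMonoidHom.coe_mk, ZeroHom.coe_mk, Pi.add_apply,
      Finsupp.equivFunOnFinite_symm_apply_apply]
    omega

instance isIntegrallyClosed_laurent [Finite σ] :
    IsIntegrallyClosed (AddMonoidAlgebra k (σ → ℤ)) := by
  let φ : MvPolynomial σ k →+* AddMonoidAlgebra k (σ → ℤ) := mapDomainRingHom k (exponentHom σ)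
  let _ : Algebra (MvPolynomial σ k) (AddMonoidAlgebra k (σ → ℤ)) := φ.toAlgebra
  have hφ (q : σ →₀ ℕ) : φ (single q 1) = single (exponentHom σ q) 1 := by simp [φ]
  let M : Submonoid (MvPolynomial σ k) := MonoidHom.mrange (of k (σ →₀ ℕ))
  have hM : M ≤ nonZeroDivisors _ := by
    rintro _ ⟨q, rfl⟩
    refine mem_nonZeroDivisors_of_ne_zero ?_
    simp [of, ← coeff_eq_zero]
  have : IsLocalization M (AddMonoidAlgebra k (σ → ℤ)) := by
    refine ⟨⟨?_, ?_, ?_⟩⟩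
    · rintro ⟨_, q, rfl⟩
      refine IsUnit.of_mul_eq_one (single (-exponentHom σ q.toAdd) 1) ?_
      change φ (single q.toAdd 1) * _ = 1
      rw [hφ, single_mul_single]
      simp [one_def]
    · intro f
      obtain ⟨q, g, e⟩ := exists_mul_single_eq_mapDomain k σ f
      refine ⟨⟨g, ⟨single q 1, ⟨Multiplicative.ofAdd q, rfl⟩⟩⟩, ?_⟩
      change f * φ (single q 1) = φ g
      rw [hφ, e]
    · intro x y h
      have : x = y := mapDomain_injective (exponentHom_injective σ) h
      exact ⟨1, by rw [this]⟩
  exact isIntegrallyClosed_of_isLocalization _ M hM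

end Laurent

section Restrict

variable {k G : Type*} [CommSemiring k]

open Classical in
/-- Discard all terms whose exponent lies outside `s`. -/
noncomputable def restrict (s : Set G) : AddMonoidAlgebra k G →+ AddMonoidAlgebra k G where
  toFun f := ofCoeff (f.coeff.filter (· ∈ s))
  map_zero' := by ext; simp [Finsupp.filter_apply]
  map_add' f g := by ext; simp [Finsupp.filter_add]

open Classical in
lemma coeff_restrict (s : Set G) (f : AddMonoidAlgebra k G) (a : G) :
    (restrict s f).coeff a = if a ∈ s then f.coeff a else 0 := by
  simp [restrict, Finsupp.filter_apply]

lemma restrict_eq_self {s : Set G} {f : AddMonoidAlgebra k G} (h : ∀ a ∈ f.coeff.support, a ∈ s) :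
    restrict s f = f := by
  classical
  ext a
  rw [coeff_restrict, ite_eq_left_iff]
  intro ha
  by_contra h0
  exact ha (h a (Finsupp.mem_support_iff.2 (Ne.symm h0)))

open Classical in
lemma restrict_single (s : Set G) (a : G) (r : k) :
    restrict s (single a r) = if a ∈ s then single a r else 0 := by
  split_ifs with h <;> ext b <;> rw [coeff_restrict] <;> by_cases hb : b = a <;> simp_all

lemma restrict_mul [AddMonoid G] {s : Set G} {f g : AddMonoidAlgebra k G}
    (h : ∀ a ∈ f.coeff.support, ∀ b ∈ g.coeff.support, a + b ∈ s ↔ a ∈ s ∧ b ∈ s) :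
    restrict s (f * g) = restrict s f * restrict s g := by
  classical
  have hsum (f : AddMonoidAlgebra k G) : f = ∑ a ∈ f.coeff.support, single a (f.coeff a) := by
    ext; simp [Finsupp.single_apply]
  conv_lhs => rw [hsum f, hsum g, Finset.sum_mul_sum]
  conv_rhs => rw [hsum f, hsum g, map_sum, map_sum, Finset.sum_mul_sum]
  simp only [map_sum]
  refine Finset.sum_congr rfl fun a ha => Finset.sum_congr rfl fun b hb => ?_
  simp only [single_mul_single, restrict_single, h a ha b hb]
  by_cases ha' : a ∈ s <;> by_cases hb' : b ∈ s <;> simp [ha', hb', single_mul_single]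

end Restrict

section SupportedSubalgebra

variable (k : Type*) {G : Type*} [CommSemiring k]

/-- The algebra of a submonoid, inside the algebra of the ambient monoid. -/
noncomputable def supportedSubalgebra [AddMonoid G] (M : AddSubmonoid G) :
    Subalgebra k (AddMonoidAlgebra k G) :=
  (supported k k (M : Set G)).toSubalgebra
    (by
      classical
      intro a ha
      have := support_coeff_one_subset ha
      simp_all)
    (by
      classical
      intro f g hf hg a ha
      obtain ⟨b, hb, c, hc, rfl⟩ := Finset.mem_add.1 (support_coeff_mul_subset f g ha)
      exact M.add_mem (hf hb) (hg hc))

variable {k}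

lemma mem_supportedSubalgebra [AddMonoid G] {M : AddSubmonoid G} {f : AddMonoidAlgebra k G} :
    f ∈ supportedSubalgebra k M ↔ ∀ a ∈ f.coeff.support, a ∈ M := Iff.rfl

lemma single_mem_supportedSubalgebra [AddMonoid G] {M : AddSubmonoid G} {a : G} (ha : a ∈ M)
    (r : k) : single a r ∈ supportedSubalgebra k M := by
  classical
  intro b hb
  have := Finsupp.support_single_subset hb
  simp_all

lemma supportedSubalgebra_mono [AddMonoid G] {M N : AddSubmonoid G} (h : M ≤ N) :
    supportedSubalgebra k M ≤ supportedSubalgebra k N :=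
  fun _ hf _ ha => h (hf ha)

lemma adjoin_single_eq_supportedSubalgebra [AddCommMonoid G] (s : Set G) :
    Algebra.adjoin k ((fun a => (single a 1 : AddMonoidAlgebra k G)) '' s) =
      supportedSubalgebra k (AddSubmonoid.closure s) := by
  classical
  apply le_antisymm
  · rw [Algebra.adjoin_le_iff]
    rintro _ ⟨a, ha, rfl⟩
    exact single_mem_supportedSubalgebra (AddSubmonoid.subset_closure ha) 1
  · intro f hf
    have hone (a : G) (ha : a ∈ AddSubmonoid.closure s) : (single a 1 : AddMonoidAlgebra k G) ∈
        Algebra.adjoin k ((fun a => (single a 1 : AddMonoidAlgebra k G)) '' s) := by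
      induction ha using AddSubmonoid.closure_induction with
      | mem a ha => exact Algebra.subset_adjoin ⟨a, ha, rfl⟩
      | zero => exact one_mem _
      | add a b _ _ iha ihb => simpa [single_mul_single] using mul_mem iha ihb
    have hsum : f = ∑ a ∈ f.coeff.support, f.coeff a • single a (1 : k) := by
      ext; simp [Finsupp.single_apply]
    rw [hsum]
    exact sum_mem fun a ha => Subalgebra.smul_mem _ (hone a (hf ha)) _

end SupportedSubalgebra

section Integral

variable {k G : Type*} [CommRing k] [AddCommGroup G]

/-- Projection from the algebra of a submonoid onto that of its group of units. -/
noncomputable def restrictUnits (P : AddSubmonoid G) :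
    supportedSubalgebra k P →+* AddMonoidAlgebra k G where
  toFun f := restrict {a | a ∈ P ∧ -a ∈ P} f.1
  map_zero' := map_zero _
  map_add' f g := map_add _ f.1 g.1
  map_one' := by
    classical
    change restrict _ (single 0 1) = single 0 1
    simp [restrict_single]
  map_mul' f g := by
    refine restrict_mul fun a ha b hb => ?_
    have ha := f.2 ha
    have hb := g.2 hb
    refine ⟨fun h => ⟨⟨ha, ?_⟩, hb, ?_⟩, fun h => ⟨P.add_mem ha hb, ?_⟩⟩
    · simpa using P.add_mem h.2 hb
    · simpa using P.add_mem h.2 ha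
    · simpa [add_comm] using P.add_mem h.1.2 h.2.2

lemma exists_forall_sub_mem {P : AddSubmonoid G} (hP : ∀ g, g ∈ P ∨ -g ∈ P) {s : Finset G}
    (hs : s.Nonempty) : ∃ m ∈ s, ∀ a ∈ s, a - m ∈ P := by
  induction hs using Finset.Nonempty.cons_induction with
  | singleton a => exact ⟨a, by simp⟩
  | cons a s ha hs ih =>
    obtain ⟨m, hm, h⟩ := ih
    rcases hP (a - m) with h' | h'
    · exact ⟨m, by simp [hm], by simpa [h'] using h⟩
    · refine ⟨a, by simp, ?_⟩
      simp only [Finset.mem_cons, forall_eq_or_imp, sub_self, P.zero_mem, true_and]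
      intro b hb
      simpa using P.add_mem (h b hb) h'

lemma mem_supportedSubalgebra_of_isIntegral [IsDomain (AddMonoidAlgebra k G)]
    {P : AddSubmonoid G} (hP : ∀ g, g ∈ P ∨ -g ∈ P) {h : AddMonoidAlgebra k G}
    (hh : IsIntegral (supportedSubalgebra k P) h) : h ∈ supportedSubalgebra k P := by
  classical
  by_contra hmem
  simp only [mem_supportedSubalgebra, not_forall] at hmem
  obtain ⟨u, hu, huP⟩ := hmem
  obtain ⟨m, hm, hmin⟩ := exists_forall_sub_mem hP ⟨u, hu⟩
  have hmP : m ∉ P := fun hmP => huP (by simpa using P.add_mem (hmin u hu) hmP)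
  have hmP' : -m ∈ P := (hP m).resolve_left hmP
  let t : supportedSubalgebra k P := ⟨single (-m) 1, single_mem_supportedSubalgebra hmP' 1⟩
  have hcoeff (a : G) : (single (-m) 1 * h).coeff a = h.coeff (a + m) := by
    simp [coeff_single_mul_apply, add_comm]
  let w : supportedSubalgebra k P := ⟨single (-m) 1 * h, by
    intro a ha
    have ha : a + m ∈ h.coeff.support :=
      Finsupp.mem_support_iff.2 (hcoeff a ▸ Finsupp.mem_support_iff.1 ha)
    simpa using hmin _ ha⟩
  have ht : restrictUnits P t = 0 := by
    change restrict _ (single (-m) 1) = 0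
    simp [restrict_single, hmP]
  have hw : restrictUnits P w ≠ 0 := by
    intro h0
    have h1 : (restrictUnits P w).coeff 0 = h.coeff m := by
      change (restrict _ (single (-m) 1 * h)).coeff 0 = _
      rw [coeff_restrict, hcoeff]
      simp
    rw [h0] at h1
    exact Finsupp.mem_support_iff.1 hm h1.symm
  obtain ⟨p, hp, hp0⟩ := hh
  have hroot : (p.scaleRoots t).eval w = 0 := by
    apply Subtype.val_injective
    have := Polynomial.scaleRoots_eval₂_eq_zero (s := t) (algebraMap _ _) hp0
    rw [show algebraMap _ (AddMonoidAlgebra k G) t * h = algebraMap _ _ w from rfl,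
      Polynomial.eval₂_at_apply] at this
    exact this
  have := congrArg (restrictUnits P) hroot
  rw [map_zero, ← Polynomial.eval₂_at_apply, Polynomial.eval₂_eq_eval_map,
    Polynomial.map_scaleRoots _ _ _ (by
      rw [hp.leadingCoeff, map_one]; exact one_ne_zero), ht, Polynomial.scaleRoots_zero,
    (hp.map _).leadingCoeff] at this
  simp only [one_smul, Polynomial.eval_pow, Polynomial.eval_X] at this
  exact hw (eq_zero_of_pow_eq_zero this)

end Integral

end AddMonoidAlgebra

/-- A submonoid containing no positive multiple of `u` extends to a submonoid that avoids `u` and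
contains every element of the group or its negative. -/
lemma AddSubmonoid.exists_total_notMem {G : Type*} [AddCommGroup G] (M : AddSubmonoid G) {u : G}
    (hu : ∀ n : ℕ, 0 < n → n • u ∉ M) :
    ∃ P : AddSubmonoid G, M ≤ P ∧ (∀ g, g ∈ P ∨ -g ∈ P) ∧ u ∉ P := by
  obtain ⟨P, hMP, hP, hmax⟩ := zorn_le_nonempty₀
    {P : AddSubmonoid G | ∀ n : ℕ, 0 < n → n • u ∉ P} (by
      intro c hc hchain y hy
      refine ⟨sSup c, fun n hn hmem => ?_, fun z hz => le_sSup hz⟩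
      obtain ⟨Q, hQ, hQu⟩ := (AddSubmonoid.mem_sSup_of_directedOn ⟨y, hy⟩ hchain.directedOn).1 hmem
      exact hc hQ n hn hQu) M hu
  have key (g : G) (hg : g ∉ P) : ∃ n : ℕ, 0 < n ∧ ∃ p ∈ P, ∃ l : ℕ, p + l • g = n • u := by
    by_contra! hcon
    have hmem : P ⊔ AddSubmonoid.multiples g ∈
        {P : AddSubmonoid G | ∀ n : ℕ, 0 < n → n • u ∉ P} := by
      intro n hn hmem
      obtain ⟨p, hp, _, ⟨l, rfl⟩, e⟩ := AddSubmonoid.mem_sup.1 hmem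
      exact hcon n hn p hp l e
    exact hg (hmax hmem le_sup_left
      (AddSubmonoid.mem_sup_right (AddSubmonoid.mem_multiples g)))
  refine ⟨P, hMP, fun g => ?_, fun h => hP 1 one_pos (by simpa using h)⟩
  by_contra! hg
  obtain ⟨n, hn, p, hp, l, e₁⟩ := key g hg.1
  obtain ⟨m, hm, q, hq, j, e₂⟩ := key (-g) hg.2
  rcases Nat.eq_zero_or_pos j with rfl | hj
  · exact hP m hm (by simpa [← e₂] using hq)
  · refine hP (j * n + l * m) (by positivity) ?_
    have : (j * n + l * m) • u = j • p + l • q := by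
      rw [add_smul, mul_smul, mul_smul, ← e₁, ← e₂]
      simp only [smul_add, smul_neg, smul_smul, mul_comm]
      abel
    rw [this]
    exact P.add_mem (P.nsmul_mem hp j) (P.nsmul_mem hq l)

/-- Elements of the group generated by `s` are differences of elements of the monoid generated by
`s`. -/
lemma AddSubgroup.exists_add_eq_of_mem_closure {G : Type*} [AddCommGroup G] {s : Set G} {v : G}
    (hv : v ∈ AddSubgroup.closure s) :
    ∃ p ∈ AddSubmonoid.closure s, ∃ q ∈ AddSubmonoid.closure s, v + q = p := by
  induction hv using AddSubgroup.closure_induction with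
  | mem x hx => exact ⟨x, AddSubmonoid.subset_closure hx, 0, zero_mem _, by simp⟩
  | zero => exact ⟨0, zero_mem _, 0, zero_mem _, by simp⟩
  | add x y _ _ hx hy =>
    obtain ⟨p, hp, q, hq, rfl⟩ := hx
    obtain ⟨p', hp', q', hq', rfl⟩ := hy
    exact ⟨_, add_mem hp hp', _, add_mem hq hq', by abel⟩
  | neg x _ hx =>
    obtain ⟨p, hp, q, hq, rfl⟩ := hx
    exact ⟨q, hq, _, hp, by abel⟩

namespace AddMonoidAlgebra

lemma mem_supportedSubalgebra_of_isIntegral_of_forall_nsmul {k G : Type*} [CommRing k]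
    [AddCommGroup G] [IsDomain (AddMonoidAlgebra k G)] {M : AddSubmonoid G} {Z : AddSubgroup G}
    (hM : ∀ v ∈ Z, ∀ n : ℕ, 0 < n → n • v ∈ M → v ∈ M) {h : AddMonoidAlgebra k G}
    (hh : IsIntegral (supportedSubalgebra k M) h) (hZ : ∀ a ∈ h.coeff.support, a ∈ Z) :
    h ∈ supportedSubalgebra k M := by
  intro u hu
  by_contra huM
  obtain ⟨P, hMP, hP, huP⟩ := M.exists_total_notMem fun n hn hmem => huM (hM u (hZ u hu) n hn hmem)
  refine huP (mem_supportedSubalgebra_of_isIntegral hP ?_ hu)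
  exact hh.map_of_comp_eq (Subalgebra.inclusion (supportedSubalgebra_mono hMP)).toRingHom
    (RingHom.id _) rfl

/-- The algebra of a submonoid that is saturated in a subgroup containing it is integrally closed,
provided the algebra of the ambient group is. -/
theorem isIntegrallyClosed_supportedSubalgebra {k G : Type*} [CommRing k] [AddCommGroup G]
    [IsDomain (AddMonoidAlgebra k G)] [IsIntegrallyClosed (AddMonoidAlgebra k G)]
    {M : AddSubmonoid G} {Z : AddSubgroup G} (hMZ : ∀ v ∈ M, v ∈ Z)
    (hM : ∀ v ∈ Z, ∀ n : ℕ, 0 < n → n • v ∈ M → v ∈ M) :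
    IsIntegrallyClosed (supportedSubalgebra k M) := by
  let S := supportedSubalgebra k M
  let L := AddMonoidAlgebra k G
  have hinj : Function.Injective (algebraMap S L) := Subtype.val_injective
  refine (isIntegrallyClosed_iff (FractionRing S)).2 fun {y} hy => ?_
  let φ : FractionRing S →+* FractionRing L := IsFractionRing.map hinj
  have hφ (s : S) : φ (algebraMap S _ s) = algebraMap L _ (algebraMap S L s) :=
    IsLocalization.map_eq _ s
  have hφy : IsIntegral S (φ y) := by
    refine hy.map_of_comp_eq (RingHom.id S) φ ?_
    ext s
    exact (hφ s).symm
  obtain ⟨h, hhy⟩ := IsIntegrallyClosed.isIntegral_iff.1 (hφy.tower_top (A := L))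
  have hh : IsIntegral S h := by
    rw [← hhy] at hφy
    exact (isIntegral_algebraMap_iff (IsFractionRing.injective L (FractionRing L))).1 hφy
  obtain ⟨f, g, hg, rfl⟩ := IsFractionRing.div_surjective (A := S) y
  have hg0 : algebraMap S L g ≠ 0 := by
    rw [Ne, FaithfulSMul.algebraMap_eq_zero_iff]
    exact nonZeroDivisors.ne_zero hg
  have hmul : h * g.1 = f.1 := by
    apply IsFractionRing.injective L (FractionRing L)
    rw [map_mul, hhy, map_div₀, hφ, hφ]
    refine div_mul_cancel₀ _ ?_
    rwa [Ne, FaithfulSMul.algebraMap_eq_zero_iff]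
  have hrestrict : restrict (Z : Set G) h = h := by
    refine mul_right_cancel₀ (b := g.1) hg0 ?_
    have hgZ : restrict (Z : Set G) g.1 = g.1 := restrict_eq_self fun a ha => hMZ a (g.2 ha)
    have hfZ : restrict (Z : Set G) f.1 = f.1 := restrict_eq_self fun a ha => hMZ a (f.2 ha)
    have hmulZ : restrict (Z : Set G) (h * g.1) =
        restrict (Z : Set G) h * restrict (Z : Set G) g.1 :=
      restrict_mul fun a _ b hb => by
        have := hMZ b (g.2 hb)
        simp [this, Z.add_mem_cancel_right this]
    rw [hmul, hfZ, hgZ] at hmulZ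
    rw [← hmulZ, hmul]
  have hhZ : ∀ a ∈ h.coeff.support, a ∈ Z := by
    intro a ha
    by_contra haZ
    rw [Finsupp.mem_support_iff, ← hrestrict, coeff_restrict] at ha
    exact ha (if_neg haZ)
  refine ⟨⟨h, mem_supportedSubalgebra_of_isIntegral_of_forall_nsmul hM hh hhZ⟩, ?_⟩
  rw [eq_div_iff ((map_ne_zero_iff _ (IsFractionRing.injective S (FractionRing S))).2
    (nonZeroDivisors.ne_zero hg)), ← map_mul]
  exact congrArg _ (Subtype.ext hmul)

theorem mem_of_nsmul_mem_of_isIntegrallyClosed {k G : Type*} [CommRing k] [AddCommGroup G]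
    [IsDomain (AddMonoidAlgebra k G)] [Nontrivial k]
    {M : AddSubmonoid G} [IsIntegrallyClosed (supportedSubalgebra k M)] {v p q : G}
    (hp : p ∈ M) (hq : q ∈ M) (hv : v + q = p) {n : ℕ} (hn : 0 < n) (hnv : n • v ∈ M) : v ∈ M := by
  let x (a : G) (ha : a ∈ M) : supportedSubalgebra k M :=
    ⟨single a 1, single_mem_supportedSubalgebra ha 1⟩
  have hdvd : x q hq ∣ x p hp := by
    rw [← IsIntegrallyClosed.pow_dvd_pow_iff hn.ne']
    refine ⟨x _ hnv, Subtype.ext ?_⟩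
    simp [x, single_pow, single_mul_single, ← hv, add_comm]
  obtain ⟨s, hs⟩ := hdvd
  have hs : single p 1 = single q 1 * s.1 := congrArg Subtype.val hs
  refine s.2 (Finsupp.mem_support_iff.2 ?_)
  have := congrArg (fun f => f.coeff p) hs
  simp only [coeff_single, Finsupp.single_eq_same, coeff_single_mul_apply, one_mul] at this
  rw [show v = -q + p by rw [← hv]; abel]
  exact this ▸ one_ne_zero

end AddMonoidAlgebra

lemma exists_nsmul_mem_closure_of_rat_combination {ι : Type*} {A : Finset (ι → ℤ)} {v : ι → ℤ}
    {c : (ι → ℤ) → ℚ} (hc : ∀ x, 0 ≤ c x) (hv : ∀ i, (v i : ℚ) = ∑ x ∈ A, c x * (x i : ℚ)) :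
    ∃ n : ℕ, 0 < n ∧ n • v ∈ AddSubmonoid.closure (A : Set (ι → ℤ)) := by
  classical
  let n := ∏ x ∈ A, (c x).den
  have hk (x) (hx : x ∈ A) : ∃ k : ℕ, (k : ℚ) = n * c x := by
    refine ⟨(∏ y ∈ A.erase x, (c y).den) * (c x).num.toNat, ?_⟩
    have hnum : (((c x).num.toNat : ℤ) : ℚ) = (c x).num := by
      rw [Int.toNat_of_nonneg (Rat.num_nonneg.2 (hc x))]
    have hn : n = (∏ y ∈ A.erase x, (c y).den) * (c x).den := (Finset.prod_erase_mul A _ hx).symm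
    rw [hn]
    push_cast at hnum ⊢
    rw [hnum, mul_assoc, mul_comm ((c x).den : ℚ), Rat.mul_den_eq_num]
  choose! k hk using hk
  refine ⟨n, Finset.prod_pos fun x _ => (c x).den_pos, ?_⟩
  have : n • v = ∑ x ∈ A, k x • x := by
    ext i
    have : (n * v i : ℚ) = ∑ x ∈ A, (k x : ℚ) * x i := by
      rw [hv, Finset.mul_sum]
      exact Finset.sum_congr rfl fun x hx => by rw [hk x hx, mul_assoc]
    simp only [Pi.smul_apply, Finset.sum_apply, nsmul_eq_mul]
    exact_mod_cast this
  rw [this]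
  exact sum_mem fun x hx => nsmul_mem (AddSubmonoid.subset_closure hx) _

lemma exists_rat_combination_of_nsmul_mem_closure {ι : Type*} {A : Finset (ι → ℤ)} {v : ι → ℤ}
    {n : ℕ} (hn : 0 < n) (hv : n • v ∈ AddSubmonoid.closure (A : Set (ι → ℤ))) :
    ∃ c : (ι → ℤ) → ℚ, (∀ x, 0 ≤ c x) ∧ ∀ i, (v i : ℚ) = ∑ x ∈ A, c x * (x i : ℚ) := by
  obtain ⟨k, -, hk⟩ := AddSubmonoid.mem_closure_finset.1 hv
  refine ⟨fun x => k x / n, fun x => by positivity, fun i => ?_⟩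
  have h : ∑ x ∈ A, (k x : ℚ) * x i = n * v i := by
    have := congrFun hk i
    simp only [Finset.sum_apply, Pi.smul_apply, nsmul_eq_mul] at this
    exact_mod_cast this
  have hn₀ : (n : ℚ) ≠ 0 := by positivity
  simp_rw [div_mul_eq_mul_div]
  rw [← Finset.sum_div, h, mul_div_cancel_left₀ _ hn₀]

/-- the affine semigroup algebra `ℂ[ℕ(A)]` (realized as the
subalgebra of the Laurent polynomial ring generated by the monomials `x^a`,
`a ∈ A`) is normal iff `ℕ(A) = ℤ(A) ∩ ℚ₊(A)`. -/
theorem semigroup_algebra_normal_iff (d : ℕ) (A : Finset (Fin d → ℤ)) :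
    IsIntegrallyClosed
        (Algebra.adjoin ℂ
          ((fun a => (AddMonoidAlgebra.single a 1 : AddMonoidAlgebra ℂ (Fin d → ℤ)))
            '' (A : Set (Fin d → ℤ)))) ↔
      {v : Fin d → ℤ |
          v ∈ AddSubgroup.closure (A : Set (Fin d → ℤ)) ∧
          ∃ c : (Fin d → ℤ) → ℚ, (∀ x, 0 ≤ c x) ∧
            ∀ i, (v i : ℚ) = ∑ x ∈ A, c x * (x i : ℚ)} =
        (AddSubmonoid.closure (A : Set (Fin d → ℤ)) : Set (Fin d → ℤ)) := by
  rw [AddMonoidAlgebra.adjoin_single_eq_supportedSubalgebra]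
  have hle : ∀ v ∈ AddSubmonoid.closure (A : Set (Fin d → ℤ)),
      v ∈ AddSubgroup.closure (A : Set (Fin d → ℤ)) := fun v hv =>
    AddSubgroup.le_closure_toAddSubmonoid _ hv
  constructor
  · intro _
    ext v
    constructor
    · rintro ⟨hv, c, hc, hvc⟩
      obtain ⟨p, hp, q, hq, e⟩ := AddSubgroup.exists_add_eq_of_mem_closure hv
      obtain ⟨n, hn, hnv⟩ := exists_nsmul_mem_closure_of_rat_combination hc hvc
      exact AddMonoidAlgebra.mem_of_nsmul_mem_of_isIntegrallyClosed (k := ℂ) hp hq e hn hnv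
    · intro hv
      exact ⟨hle v hv, exists_rat_combination_of_nsmul_mem_closure one_pos (by simpa using hv)⟩
  · intro h
    refine AddMonoidAlgebra.isIntegrallyClosed_supportedSubalgebra hle fun v hv n hn hnv => ?_
    rw [← SetLike.mem_coe, ← h]
    exact ⟨hv, exists_rat_combination_of_nsmul_mem_closure hn hnv⟩
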